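/- arXiv:2509.00627 — 2 statements merged into one kernel-verified Lean document; each statement's English description precedes it below -/
import Mathlib

section
/- For any text T of length n, any injective hash function h, indices 1 ≤ i ≤ j ≤ n, and a value v ∈ ℕ: the subsequence T[i,j] has min-hash v if and only if T[i,j] contains a key with hash value v (i.e. some (p,q) ∈ K(T[i,j]) has hash value v) and T[i,j] contains no key with hash value smaller than v. -/
/-- `freqIn T t i j` is the number of positions `p` with `i ≤ p ≤ j` and `T p = t`. -/
def freqIn {α : Type*} [DecidableEq α] (T : ℕ → α) (t : α) (i j : ℕ) : ℕ :=
  ((Finset.Icc i j).filter fun p => T p = t).card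

/-- The hash value set `H(T[i,j]) = { h(t,x) : t occurs in T[i,j], 1 ≤ x ≤ freq(t, T[i,j]) }`. -/
def hashSet {α : Type*} [DecidableEq α] (T : ℕ → α) (h : α × ℕ → ℕ) (i j : ℕ) : Set ℕ :=
  {v | ∃ t x, 1 ≤ x ∧ x ≤ freqIn T t i j ∧ v = h (t, x)}

/-- The min-hash of `T[i,j]`, the smallest element of its hash value set. -/
noncomputable def minHash {α : Type*} [DecidableEq α] (T : ℕ → α) (h : α × ℕ → ℕ)
    (i j : ℕ) : ℕ :=
  sInf (hashSet T h i j)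

/-- The hash value of a key `(p,q)` of `T`: `h(T(q), freq(T(q), T[p,q]))`. -/
def keyHash {α : Type*} [DecidableEq α] (T : ℕ → α) (h : α × ℕ → ℕ) (p q : ℕ) : ℕ :=
  h (T q, freqIn T (T q) p q)

theorem freqIn_succ {α : Type*} [DecidableEq α] (T : ℕ → α) (t : α) {i j : ℕ}
    (hij : i ≤ j + 1) :
    freqIn T t i (j + 1) = freqIn T t i j + if T (j + 1) = t then 1 else 0 := by
  unfold freqIn
  rw [← Finset.insert_Icc_right_eq_Icc_add_one hij, Finset.filter_insert]
  split_ifs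
  · rw [Finset.card_insert_of_notMem (by simp)]
  · rfl

theorem freqIn_pos_iff {α : Type*} [DecidableEq α] (T : ℕ → α) (t : α) (i j : ℕ) :
    1 ≤ freqIn T t i j ↔ ∃ p, i ≤ p ∧ p ≤ j ∧ T p = t := by
  unfold freqIn
  rw [Nat.succ_le_iff, Finset.card_pos]
  simp [Finset.Nonempty, and_assoc]

theorem freqIn_mono {α : Type*} [DecidableEq α] (T : ℕ → α) (t : α) {i j p q : ℕ}
    (hip : i ≤ p) (hqj : q ≤ j) : freqIn T t p q ≤ freqIn T t i j :=
  Finset.card_le_card (Finset.filter_subset_filter _ (Finset.Icc_subset_Icc hip hqj))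

/-- Every frequency up to `freqIn T t i j` is attained by a prefix of `T[i,j]` ending in `t`. -/
theorem exists_freqIn_prefix_eq {α : Type*} [DecidableEq α] (T : ℕ → α) (t : α) (i j x : ℕ)
    (hx : 1 ≤ x) (hxj : x ≤ freqIn T t i j) :
    ∃ q, q ≤ j ∧ T q = t ∧ freqIn T t i q = x := by
  induction j with
  | zero =>
    obtain ⟨p, -, hp0, hpt⟩ := (freqIn_pos_iff T t i 0).1 (hx.trans hxj)
    obtain rfl : p = 0 := by omega
    refine ⟨0, le_rfl, hpt, ?_⟩
    have hle : freqIn T t i 0 ≤ 1 :=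
      (Finset.card_filter_le _ _).trans (by rw [Nat.card_Icc]; omega)
    omega
  | succ j ih =>
    by_cases hle : x ≤ freqIn T t i j
    · obtain ⟨q, hq, hqt, hqx⟩ := ih hle
      exact ⟨q, hq.trans j.le_succ, hqt, hqx⟩
    · obtain ⟨p, hip, hpj, -⟩ := (freqIn_pos_iff T t i (j + 1)).1 (hx.trans hxj)
      have hsucc := freqIn_succ T t (hip.trans hpj)
      split_ifs at hsucc with ht
      · exact ⟨j + 1, le_rfl, ht, by omega⟩
      · omega

/-- A subsequence in which `t` occurs can be cut to start at the first occurrence of `t`. -/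
theorem exists_freqIn_suffix_eq {α : Type*} [DecidableEq α] (T : ℕ → α) (t : α) (i q : ℕ)
    (hpos : 1 ≤ freqIn T t i q) :
    ∃ p, i ≤ p ∧ p ≤ q ∧ T p = t ∧ freqIn T t p q = freqIn T t i q := by
  classical
  have hex := (freqIn_pos_iff T t i q).1 hpos
  obtain ⟨hip, hpq, hpt⟩ := Nat.find_spec hex
  refine ⟨Nat.find hex, hip, hpq, hpt, ?_⟩
  unfold freqIn
  congr 1
  ext r
  simp only [Finset.mem_filter, Finset.mem_Icc]
  exact ⟨fun hr => ⟨⟨hip.trans hr.1.1, hr.1.2⟩, hr.2⟩,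
    fun hr => ⟨⟨Nat.find_min' hex ⟨hr.1.1, hr.1.2, hr.2⟩, hr.1.2⟩, hr.2⟩⟩

/-- The hash values of `T[i,j]` are exactly the hash values of its keys. -/
theorem mem_hashSet_iff_exists_key {α : Type*} [DecidableEq α] (T : ℕ → α) (h : α × ℕ → ℕ)
    (i j v : ℕ) :
    v ∈ hashSet T h i j ↔
      ∃ p q, i ≤ p ∧ p ≤ q ∧ q ≤ j ∧ T p = T q ∧ keyHash T h p q = v := by
  constructor
  · rintro ⟨t, x, hx, hxj, rfl⟩
    obtain ⟨q, hqj, rfl, rfl⟩ := exists_freqIn_prefix_eq T t i j x hx hxj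
    obtain ⟨p, hip, hpq, hpt, hfreq⟩ := exists_freqIn_suffix_eq T (T q) i q hx
    exact ⟨p, q, hip, hpq, hqj, hpt, by rw [keyHash, hfreq]⟩
  · rintro ⟨p, q, hip, hpq, hqj, -, rfl⟩
    exact ⟨T q, freqIn T (T q) p q, (freqIn_pos_iff _ _ _ _).2 ⟨q, hpq, le_rfl, rfl⟩,
      freqIn_mono T (T q) hip hqj, rfl⟩

/-- A subsequence `T[i,j]` has min-hash `v` if and only if it contains a key with hash
value `v` and contains no key with a hash value smaller than `v`. -/
theorem minHash_eq_iff_key {α : Type*} [DecidableEq α] (T : ℕ → α) (n : ℕ)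
    (h : α × ℕ → ℕ) (hinj : Function.Injective h)
    (i j : ℕ) (h1i : 1 ≤ i) (hij : i ≤ j) (hjn : j ≤ n) (v : ℕ) :
    minHash T h i j = v ↔
      (∃ p q, i ≤ p ∧ p ≤ q ∧ q ≤ j ∧ T p = T q ∧ keyHash T h p q = v) ∧
      (∀ p q, i ≤ p → p ≤ q → q ≤ j → T p = T q → ¬ keyHash T h p q < v) := by
  have hne : (hashSet T h i j).Nonempty :=
    ⟨_, (mem_hashSet_iff_exists_key T h i j _).2 ⟨i, i, le_rfl, le_rfl, hij, rfl, rfl⟩⟩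
  rw [← mem_hashSet_iff_exists_key]
  constructor
  · rintro rfl
    refine ⟨Nat.sInf_mem hne, fun p q hip hpq hqj hT => not_lt.2 (Nat.sInf_le ?_)⟩
    exact (mem_hashSet_iff_exists_key T h i j _).2 ⟨p, q, hip, hpq, hqj, hT, rfl⟩
  · rintro ⟨hv, hmin⟩
    refine le_antisymm (Nat.sInf_le hv) (le_csInf hne fun w hw => ?_)
    obtain ⟨p, q, hip, hpq, hqj, hT, rfl⟩ := (mem_hashSet_iff_exists_key T h i j w).1 hw
    exact not_lt.1 (hmin p q hip hpq hqj hT)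
end

section
/- Let T be a text of length n, L a finite set of keys of T, and (b,c) a key of T with (b,c) ∉ L that is not dominated by any key in the augmented skyline S of L (listed S[1],…,S[l] in coordinate order). Let i be the largest index such that S[i].y < c and j the smallest index such that S[j].x > b. Define the rectangles r_i = [S[i].x+1, b] × [c, S[i+1].y − 1] and, for each k with i+1 ≤ k ≤ j−1, r_k = [S[k].x+1, b] × [S[k].y, S[k+1].y − 1]. Then r_i, r_{i+1}, …, r_{j−1} are pairwise disjoint and their union equals rec(b,c) \ rec(S). -/
/-- A key `(p,q)` *dominates* a key `(p',q')` iff `p' ≤ p`, `q ≤ q'`, and the keys are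
distinct. `Dominates s s'` means `s` dominates `s'`. -/
def Dominates (s s' : ℕ × ℕ) : Prop :=
  s'.1 ≤ s.1 ∧ s.2 ≤ s'.2 ∧ s ≠ s'

instance (s s' : ℕ × ℕ) : Decidable (Dominates s s') :=
  inferInstanceAs (Decidable (s'.1 ≤ s.1 ∧ s.2 ≤ s'.2 ∧ s ≠ s'))

/-- The skyline of a finite set `L` of keys: the keys in `L` not dominated by any key in `L`. -/
def skyline (L : Finset (ℕ × ℕ)) : Finset (ℕ × ℕ) :=
  L.filter fun s => ∀ s' ∈ L, ¬ Dominates s' s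

/-- The augmented skyline of `L` for a text of length `n`: the skyline of `L` together
with the guard keys `(0,0)` and `(n+1,n+1)`. -/
def augSkyline (n : ℕ) (L : Finset (ℕ × ℕ)) : Finset (ℕ × ℕ) :=
  insert (0, 0) (insert (n + 1, n + 1) (skyline L))

/-- Strict lexicographic order on coordinate pairs. -/
def LexLt (s s' : ℕ × ℕ) : Prop :=
  s.1 < s'.1 ∨ (s.1 = s'.1 ∧ s.2 < s'.2)

/-- The rectangle of a key `(p,q)` in a text of length `n`:
`rec(p,q) = {(i,j) : 1 ≤ i ≤ p and q ≤ j ≤ n}`. -/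
def keyRec (n p q : ℕ) : Set (ℕ × ℕ) :=
  {ij | 1 ≤ ij.1 ∧ ij.1 ≤ p ∧ q ≤ ij.2 ∧ ij.2 ≤ n}

/-- `rec(L)`: the union of the rectangles of the keys in `L`. -/
def recSet (n : ℕ) (L : Finset (ℕ × ℕ)) : Set (ℕ × ℕ) :=
  ⋃ s ∈ L, keyRec n s.1 s.2

/-- The `k`-th "staircase step" rectangle for the insertion of key `(b,c)`:
`r_i = [S[i].x+1, b] × [c, S[i+1].y − 1]` and, for `k ≠ i`,
`r_k = [S[k].x+1, b] × [S[k].y, S[k+1].y − 1]`. -/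
def stepRect (S : ℕ → ℕ × ℕ) (i b c k : ℕ) : Set (ℕ × ℕ) :=
  Set.Icc ((S k).1 + 1) b ×ˢ Set.Icc (if k = i then c else (S k).2) ((S (k + 1)).2 - 1)

theorem lt_and_lt_of_lexLt_of_mem_skyline {L : Finset (ℕ × ℕ)} {s s' : ℕ × ℕ}
    (hs : s ∈ skyline L) (hs' : s' ∈ skyline L) (h : LexLt s s') :
    s.1 < s'.1 ∧ s.2 < s'.2 := by
  simp only [skyline, Finset.mem_filter] at hs hs'
  have h₁ := hs.2 s' hs'.1
  have h₂ := hs'.2 s hs.1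
  obtain ⟨p, q⟩ := s
  obtain ⟨p', q'⟩ := s'
  simp only [Dominates, LexLt, ne_eq, Prod.mk.injEq] at *
  omega

theorem lt_and_lt_of_lexLt_of_mem_augSkyline {n : ℕ} {L : Finset (ℕ × ℕ)}
    (hL : ∀ s ∈ L, 1 ≤ s.1 ∧ s.1 ≤ s.2 ∧ s.2 ≤ n) {s s' : ℕ × ℕ}
    (hs : s ∈ augSkyline n L) (hs' : s' ∈ augSkyline n L) (h : LexLt s s') :
    s.1 < s'.1 ∧ s.2 < s'.2 := by
  have hsky : ∀ t ∈ skyline L, 1 ≤ t.1 ∧ t.1 ≤ t.2 ∧ t.2 ≤ n :=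
    fun t ht => hL t (Finset.mem_filter.1 ht).1
  simp only [augSkyline, Finset.mem_insert] at hs hs'
  rcases hs with rfl | rfl | hs <;> rcases hs' with rfl | rfl | hs'
  case inr.inr.inr.inr => exact lt_and_lt_of_lexLt_of_mem_skyline hs hs' h
  all_goals
    try have := hsky _ hs
    try have := hsky _ hs'
    simp only [LexLt] at h ⊢
    omega

theorem snd_le_of_mem_augSkyline {n : ℕ} {L : Finset (ℕ × ℕ)} (hL : ∀ s ∈ L, s.2 ≤ n)
    {s : ℕ × ℕ} (hs : s ∈ augSkyline n L) : s.2 ≤ n + 1 := by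
  simp only [augSkyline, Finset.mem_insert] at hs
  rcases hs with rfl | rfl | hs
  · simp
  · simp
  · exact (hL s (Finset.mem_filter.1 hs).1).trans n.le_succ

/-- Let `S 1, …, S l` list the augmented skyline of a finite set `L` of keys of a text
`T` in coordinate order, and let `(b,c)` be a key of `T` not in `L` that is not
dominated by any key of `S`.  Let `i` be the largest index with `S[i].y < c` and `j`
the smallest index with `S[j].x > b`.  Then the rectangles
`r_i = [S[i].x+1, b] × [c, S[i+1].y − 1]` and
`r_k = [S[k].x+1, b] × [S[k].y, S[k+1].y − 1]` for `i+1 ≤ k ≤ j−1`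
are pairwise disjoint and their union is `rec(b,c) \ rec(S)`. -/
theorem staircase_partition {α : Type*} [DecidableEq α] (T : ℕ → α) (n : ℕ)
    (L : Finset (ℕ × ℕ))
    (hL : ∀ s ∈ L, 1 ≤ s.1 ∧ s.1 ≤ s.2 ∧ s.2 ≤ n ∧ T s.1 = T s.2)
    (b c : ℕ) (h1b : 1 ≤ b) (hbc : b ≤ c) (hcn : c ≤ n) (hkey : T b = T c)
    (hbcL : (b, c) ∉ L)
    (l : ℕ) (S : ℕ → ℕ × ℕ)
    (henum : ∀ s, s ∈ augSkyline n L ↔ ∃ k, 1 ≤ k ∧ k ≤ l ∧ S k = s)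
    (hsorted : ∀ k k', 1 ≤ k → k < k' → k' ≤ l → LexLt (S k) (S k'))
    (hnotdom : ∀ k, 1 ≤ k → k ≤ l → ¬ Dominates (S k) (b, c))
    (i j : ℕ)
    (hi : 1 ≤ i ∧ i ≤ l ∧ (S i).2 < c ∧ ∀ k, 1 ≤ k → k ≤ l → (S k).2 < c → k ≤ i)
    (hj : 1 ≤ j ∧ j ≤ l ∧ b < (S j).1 ∧ ∀ k, 1 ≤ k → k ≤ l → b < (S k).1 → j ≤ k) :
    (∀ k k', i ≤ k → k < k' → k' < j →
        Disjoint (stepRect S i b c k) (stepRect S i b c k')) ∧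
    (⋃ k ∈ Set.Ico i j, stepRect S i b c k)
      = keyRec n b c \ recSet n (augSkyline n L) := by
  obtain ⟨hi1, hil, hic, himax⟩ := hi
  obtain ⟨hj1, hjl, hjb, hjmin⟩ := hj
  have hmem : ∀ k, 1 ≤ k → k ≤ l → S k ∈ augSkyline n L :=
    fun k h₁ h₂ => (henum _).2 ⟨k, h₁, h₂, rfl⟩
  have hlt : ∀ k k', 1 ≤ k → k < k' → k' ≤ l → (S k).1 < (S k').1 ∧ (S k).2 < (S k').2 :=
    fun k k' h₁ h₂ h₃ => lt_and_lt_of_lexLt_of_mem_augSkyline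
      (fun s hs => ⟨(hL s hs).1, (hL s hs).2.1, (hL s hs).2.2.1⟩)
      (hmem k h₁ (by omega)) (hmem k' (by omega) h₃) (hsorted k k' h₁ h₂ h₃)
  have hle : ∀ k k', 1 ≤ k → k ≤ k' → k' ≤ l → (S k).1 ≤ (S k').1 ∧ (S k).2 ≤ (S k').2 := by
    intro k k' h₁ h₂ h₃
    rcases h₂.eq_or_lt with rfl | h₂
    · exact ⟨le_rfl, le_rfl⟩
    · exact (hlt k k' h₁ h₂ h₃).imp le_of_lt le_of_lt
  refine ⟨?_, ?_⟩
  · intro k k' hik hkk' hk'j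
    rw [Set.disjoint_left]
    rintro ⟨x, y⟩ h h'
    simp only [stepRect, Set.mem_prod, Set.mem_Icc, if_neg (show k' ≠ i by omega)] at h h'
    have := hlt k (k + 1) (by omega) (by omega) (by omega)
    have := hle (k + 1) k' (by omega) (by omega) (by omega)
    omega
  ext ⟨x, y⟩
  simp only [Set.mem_iUnion, Set.mem_Ico, exists_prop, stepRect, Set.mem_prod, Set.mem_Icc,
    keyRec, recSet, Set.mem_sdiff, Set.mem_ofPred_eq, not_exists, not_and]
  constructor
  · rintro ⟨k, ⟨hik, hkj⟩, ⟨hx, hxb⟩, hy, hy'⟩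
    have hstep := hlt k (k + 1) (by omega) (by omega) (by omega)
    have hn := snd_le_of_mem_augSkyline (fun s hs => (hL s hs).2.2.1)
      (hmem (k + 1) (by omega) (by omega))
    have hcy : c ≤ y := by
      split_ifs at hy with hki
      · exact hy
      · by_contra hcy
        have := himax k (by omega) (by omega) (by omega)
        omega
    refine ⟨⟨by omega, hxb, hcy, by omega⟩, ?_⟩
    intro s hs _ hxs hsy
    obtain ⟨m, hm1, hml, rfl⟩ := (henum s).1 hs
    rcases le_or_gt m k with hmk | hmk
    · have := hle m k hm1 hmk (by omega)
      omega
    · have := hle (k + 1) m (by omega) hmk hml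
      omega
  · rintro ⟨⟨hx1, hxb, hcy, hyn⟩, hrec⟩
    have hij : i < j := by
      by_contra hji
      have := hle j i hj1 (by omega) (by omega)
      refine hnotdom j hj1 hjl ⟨hjb.le, by simp only; omega, fun h => ?_⟩
      rw [h] at hjb
      exact lt_irrefl _ hjb
    have hx : ∀ k, 1 ≤ k → k ≤ l → (S k).2 ≤ y → (S k).1 < x := by
      intro k hk1 hkl hky
      by_contra hxk
      exact hrec (S k) (hmem k hk1 hkl) hx1 (by omega) hky hyn
    have hyj : y < (S j).2 := by
      by_contra hyj
      have := hx j hj1 hjl (by omega)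
      omega
    obtain ⟨k, hik, hkj, hky, hyk⟩ :
        ∃ k, i ≤ k ∧ k < j ∧ (S k).2 ≤ y ∧ y < (S (k + 1)).2 := by
      by_contra! hno
      have key : ∀ m, i ≤ m → m ≤ j → (S m).2 ≤ y := by
        intro m him
        induction m, him using Nat.le_induction with
        | base => intro _; omega
        | succ m him ih => exact fun hm => hno m him hm (ih (by omega))
      have := key j hij.le le_rfl
      omega
    refine ⟨k, ⟨hik, hkj⟩, ⟨hx k (by omega) (by omega) hky, hxb⟩, ?_, by omega⟩
    split_ifs
    · exact hcy
    · exact hky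
end
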